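/- For all real numbers λ, μ with λ·μ ≠ 0, the subspace {Q ∈ W : Q(λ·e1 + μ·e2) = 0} of the Fubini–Cartan tableau W has dimension 1. Consequently the characters of W with respect to a generic flag are s'_1 = 5 and s'_2 = 1, and since dim W^(1) = 7 = s'_1 + 2·s'_2, the tableau W is involutive. -/

import Mathlib

set_option synthInstance.maxHeartbeats 1000000
set_option maxHeartbeats 1000000

open Module

noncomputable instance innerHomAddCommGroup :
    AddCommGroup ((Fin 2 → ℝ) →ₗ[ℝ] (Fin 5 → ℝ)) :=
  @LinearMap.addCommGroup ℝ ℝ (Fin 2 → ℝ) (Fin 5 → ℝ) _ _ _ _ _ _ (RingHom.id ℝ)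

noncomputable instance outerHomAddCommGroup :
    AddCommGroup ((Fin 2 → ℝ) →ₗ[ℝ] ((Fin 2 → ℝ) →ₗ[ℝ] (Fin 5 → ℝ))) :=
  @LinearMap.addCommGroup ℝ ℝ (Fin 2 → ℝ) ((Fin 2 → ℝ) →ₗ[ℝ] (Fin 5 → ℝ))
    _ _ _ _ _ _ (RingHom.id ℝ)

noncomputable instance outerHomSubAddCommGroup
    (P : Submodule ℝ ((Fin 2 → ℝ) →ₗ[ℝ] ((Fin 2 → ℝ) →ₗ[ℝ] (Fin 5 → ℝ)))) :
    AddCommGroup ↥P := by exact @Submodule.addCommGroup ℝ _ _ _ _ P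

/-- The first standard basis vector `e1` of `a = ℝ²`. -/
noncomputable def e1 : Fin 2 → ℝ := Pi.single 0 1
/-- The second standard basis vector `e2` of `a = ℝ²`. -/
noncomputable def e2 : Fin 2 → ℝ := Pi.single 1 1

/-- `memW Q q1 q2 p1 p2 r1 r2` says that `Q ∈ Hom(ℝ², ℝ⁵)` is the element
`Q(q1,q2,p1,p2,r1,r2)` of the Fubini–Cartan tableau, i.e.
`Q(e1) = (−(3/2)q1, (1/2)q1, r1, p1, r2)` and
`Q(e2) = ((3/2)q2, (1/2)q2, p2, r2, r1)`. -/
def memW (Q : (Fin 2 → ℝ) →ₗ[ℝ] (Fin 5 → ℝ))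
    (q1 q2 p1 p2 r1 r2 : ℝ) : Prop :=
  Q e1 = ![-(3/2) * q1, (1/2) * q1, r1, p1, r2] ∧
  Q e2 = ![(3/2) * q2, (1/2) * q2, p2, r2, r1]

/-- The Fubini–Cartan tableau `W ⊆ Hom(ℝ², ℝ⁵)`, the 6-dimensional subspace
of all `Q(q1,q2,p1,p2,r1,r2)` for `(q1,q2,p1,p2,r1,r2) ∈ ℝ⁶`. -/
noncomputable def W : Submodule ℝ ((Fin 2 → ℝ) →ₗ[ℝ] (Fin 5 → ℝ)) where
  carrier := {Q | ∃ q1 q2 p1 p2 r1 r2 : ℝ, memW Q q1 q2 p1 p2 r1 r2}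
  add_mem' := by
    rintro Q Q' ⟨a1, a2, a3, a4, a5, a6, h1, h2⟩ ⟨b1, b2, b3, b4, b5, b6, k1, k2⟩
    refine ⟨a1 + b1, a2 + b2, a3 + b3, a4 + b4, a5 + b5, a6 + b6, ?_, ?_⟩ <;>
      · simp only [LinearMap.add_apply, h1, h2, k1, k2]
        funext i; fin_cases i <;> simp <;> ring
  zero_mem' := by
    refine ⟨0, 0, 0, 0, 0, 0, ?_, ?_⟩ <;>
      · funext i; fin_cases i <;> simp
  smul_mem' := by
    rintro c Q ⟨a1, a2, a3, a4, a5, a6, h1, h2⟩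
    refine ⟨c * a1, c * a2, c * a3, c * a4, c * a5, c * a6, ?_, ?_⟩ <;>
      · simp only [LinearMap.smul_apply, h1, h2]
        funext i; fin_cases i <;> simp <;> ring

/-- The first prolongation `T⁽¹⁾ = {F ∈ Hom(ℝ², T) : F(e1)(e2) = F(e2)(e1)}`
of a linear subspace `T ⊆ Hom(ℝ², ℝ⁵)`, where `Hom(ℝ², T)` is realized as
the space of linear maps `ℝ² → Hom(ℝ², ℝ⁵)` all of whose values lie in `T`. -/
noncomputable def prolong (T : Submodule ℝ ((Fin 2 → ℝ) →ₗ[ℝ] (Fin 5 → ℝ))) :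
    Submodule ℝ ((Fin 2 → ℝ) →ₗ[ℝ] ((Fin 2 → ℝ) →ₗ[ℝ] (Fin 5 → ℝ))) where
  carrier := {F | (∀ v, F v ∈ T) ∧ F e1 e2 = F e2 e1}
  add_mem' := by
    rintro F G ⟨hF1, hF2⟩ ⟨hG1, hG2⟩
    exact ⟨fun v => T.add_mem (hF1 v) (hG1 v), by
      simp [LinearMap.add_apply, hF2, hG2]⟩
  zero_mem' := ⟨fun v => T.zero_mem, by simp⟩
  smul_mem' := by
    rintro c F ⟨hF1, hF2⟩
    exact ⟨fun v => T.smul_mem c (hF1 v), by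
      simp [LinearMap.smul_apply, hF2]⟩

/-- The subspace `{Q ∈ T : Q(v) = 0}` of a linear subspace
`T ⊆ Hom(ℝ², ℝ⁵)`: the elements of `T` vanishing on (the line spanned by)
`v`, i.e. on the first subspace of the flag determined by `v`. -/
noncomputable def vanishAt (T : Submodule ℝ ((Fin 2 → ℝ) →ₗ[ℝ] (Fin 5 → ℝ)))
    (v : Fin 2 → ℝ) : Submodule ℝ ((Fin 2 → ℝ) →ₗ[ℝ] (Fin 5 → ℝ)) where
  carrier := {Q | Q ∈ T ∧ Q v = 0}
  add_mem' := by
    rintro Q Q' ⟨hQ1, hQ2⟩ ⟨hQ'1, hQ'2⟩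
    exact ⟨T.add_mem hQ1 hQ'1, by simp [LinearMap.add_apply, hQ2, hQ'2]⟩
  zero_mem' := ⟨T.zero_mem, by simp⟩
  smul_mem' := by
    rintro c Q ⟨hQ1, hQ2⟩
    exact ⟨T.smul_mem c hQ1, by simp [LinearMap.smul_apply, hQ2]⟩

theorem finrank_eq_of_parametrization {n : ℕ} {V : Type*} [AddCommGroup V] [Module ℝ V]
    {P : Submodule ℝ V} (f : (Fin n → ℝ) →ₗ[ℝ] V) (hf : ∀ c, f c = 0 → c = 0)
    (hP : ∀ x, x ∈ P ↔ ∃ c, f c = x) : finrank ℝ P = n := by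
  obtain rfl : P = LinearMap.range f := by
    ext x
    rw [hP, LinearMap.mem_range]
  rw [LinearMap.finrank_range_of_inj ((injective_iff_map_eq_zero f).2 hf), finrank_fin_fun]

/-- The linear map `ℝ² → M` with prescribed values on the standard basis. -/
noncomputable def homOfValues (M : Type*) [AddCommGroup M] [Module ℝ M] :
    (Fin 2 → M) ≃ₗ[ℝ] ((Fin 2 → ℝ) →ₗ[ℝ] M) :=
  (Pi.basisFun ℝ (Fin 2)).constr ℝ

section homOfValues

variable {M : Type*} [AddCommGroup M] [Module ℝ M]

theorem homOfValues_e1 (u : Fin 2 → M) : homOfValues M u e1 = u 0 := by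
  simp [homOfValues, e1]

theorem homOfValues_e2 (u : Fin 2 → M) : homOfValues M u e2 = u 1 := by
  simp [homOfValues, e2]

theorem eq_smul_e1_add_smul_e2 (v : Fin 2 → ℝ) : v = v 0 • e1 + v 1 • e2 := by
  funext i
  fin_cases i <;> simp [e1, e2]

theorem hom_ext_e1_e2 {F G : (Fin 2 → ℝ) →ₗ[ℝ] M} (h1 : F e1 = G e1) (h2 : F e2 = G e2) :
    F = G := by
  refine LinearMap.ext fun v => ?_
  rw [eq_smul_e1_add_smul_e2 v]
  simp only [map_add, map_smul, h1, h2]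

end homOfValues

/-- The parametrization `(q1, q2, p1, p2, r1, r2) ↦ Q(q1, q2, p1, p2, r1, r2)` of the tableau. -/
noncomputable def tableauMap : (Fin 6 → ℝ) →ₗ[ℝ] ((Fin 2 → ℝ) →ₗ[ℝ] (Fin 5 → ℝ)) :=
  (homOfValues (Fin 5 → ℝ)).toLinearMap ∘ₗ
    { toFun := fun c => ![![-(3/2) * c 0, (1/2) * c 0, c 4, c 2, c 5],
        ![(3/2) * c 1, (1/2) * c 1, c 3, c 5, c 4]]
      map_add' := by
        intro c d
        funext i j
        fin_cases i <;> fin_cases j <;> simp <;> ring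
      map_smul' := by
        intro a c
        funext i j
        fin_cases i <;> fin_cases j <;> simp <;> ring }

theorem tableauMap_e1 (c : Fin 6 → ℝ) :
    tableauMap c e1 = ![-(3/2) * c 0, (1/2) * c 0, c 4, c 2, c 5] := by
  simp [tableauMap, homOfValues_e1]

theorem tableauMap_e2 (c : Fin 6 → ℝ) :
    tableauMap c e2 = ![(3/2) * c 1, (1/2) * c 1, c 3, c 5, c 4] := by
  simp [tableauMap, homOfValues_e2]

theorem mem_W_iff (Q : (Fin 2 → ℝ) →ₗ[ℝ] (Fin 5 → ℝ)) : Q ∈ W ↔ ∃ c, tableauMap c = Q := by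
  constructor
  · rintro ⟨q1, q2, p1, p2, r1, r2, h1, h2⟩
    refine ⟨![q1, q2, p1, p2, r1, r2], hom_ext_e1_e2 ?_ ?_⟩
    · rw [tableauMap_e1, h1]
      simp
    · rw [tableauMap_e2, h2]
      simp
  · rintro ⟨c, rfl⟩
    exact ⟨c 0, c 1, c 2, c 3, c 4, c 5, tableauMap_e1 c, tableauMap_e2 c⟩

theorem tableauMap_eq_zero (c : Fin 6 → ℝ) (h : tableauMap c = 0) : c = 0 := by
  have h1 := tableauMap_e1 c
  have h2 := tableauMap_e2 c
  rw [h, LinearMap.zero_apply] at h1 h2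
  have a := congrFun h1
  have b := congrFun h2
  simp [Fin.forall_fin_succ] at a b
  funext i
  fin_cases i <;> simp <;> grind

theorem finrank_W : finrank ℝ W = 6 :=
  finrank_eq_of_parametrization tableauMap tableauMap_eq_zero mem_W_iff

/-- The parameters of the elements of the tableau vanishing on `lam • e1 + mu • e2`. -/
noncomputable def vanishingParams (lam mu : ℝ) : (Fin 1 → ℝ) →ₗ[ℝ] (Fin 6 → ℝ) where
  toFun t := t 0 • ![0, 0, mu ^ 3, -lam ^ 3, lam ^ 2 * mu, -lam * mu ^ 2]
  map_add' s t := by simp only [Pi.add_apply, add_smul]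
  map_smul' a t := by simp only [Pi.smul_apply, smul_assoc, RingHom.id_apply]

theorem tableauMap_apply_eq_zero_iff {lam mu : ℝ} (h : lam * mu ≠ 0) (c : Fin 6 → ℝ) :
    tableauMap c (lam • e1 + mu • e2) = 0 ↔ ∃ t, vanishingParams lam mu t = c := by
  obtain ⟨hl, hm⟩ := mul_ne_zero_iff.1 h
  rw [map_add, map_smul, map_smul, tableauMap_e1, tableauMap_e2]
  constructor
  · intro hc
    have a := congrFun hc
    simp [Fin.forall_fin_succ] at a
    obtain ⟨a0, a1, a2, a3, a4⟩ := a
    refine ⟨fun _ => c 4 / (lam ^ 2 * mu), ?_⟩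
    have hq1 : lam * c 0 = 0 := by linarith
    have hq2 : mu * c 1 = 0 := by linarith
    funext i
    fin_cases i <;> simp [vanishingParams]
    · simpa [hl, eq_comm] using hq1
    · simpa [hm, eq_comm] using hq2
    · field_simp
      linear_combination mu * a4 - lam * a3
    · field_simp
      linear_combination -a2
    · field_simp
    · field_simp
      linear_combination -a4
  · rintro ⟨t, rfl⟩
    funext i
    fin_cases i <;> simp [vanishingParams] <;> ring

theorem finrank_vanishAt_W {lam mu : ℝ} (h : lam * mu ≠ 0) :
    finrank ℝ (vanishAt W (lam • e1 + mu • e2)) = 1 := by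
  refine finrank_eq_of_parametrization (tableauMap ∘ₗ vanishingParams lam mu) ?_ ?_
  · intro t ht
    have h3 := congrFun (tableauMap_eq_zero _ ht) 2
    have hm := (mul_ne_zero_iff.1 h).2
    funext i
    fin_cases i
    simpa [vanishingParams, hm] using h3
  · intro Q
    change Q ∈ W ∧ Q (lam • e1 + mu • e2) = 0 ↔ _
    rw [mem_W_iff]
    constructor
    · rintro ⟨⟨c, rfl⟩, hc⟩
      obtain ⟨t, rfl⟩ := (tableauMap_apply_eq_zero_iff h c).1 hc
      exact ⟨t, rfl⟩
    · rintro ⟨t, rfl⟩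
      exact ⟨⟨_, rfl⟩, (tableauMap_apply_eq_zero_iff h _).2 ⟨t, rfl⟩⟩

/-- The parameters `(F(e1), F(e2))` of the elements `F` of the first prolongation. -/
noncomputable def prolongParams : (Fin 7 → ℝ) →ₗ[ℝ] (Fin 2 → Fin 6 → ℝ) where
  toFun c := ![![c 0, 0, c 1, c 6, c 2, c 3], ![0, c 4, c 3, c 5, c 6, c 2]]
  map_add' c d := by
    funext i j
    fin_cases i <;> fin_cases j <;> simp
  map_smul' a c := by
    funext i j
    fin_cases i <;> fin_cases j <;> simp

theorem tableauMap_symm_iff (c d : Fin 6 → ℝ) :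
    tableauMap c e2 = tableauMap d e1 ↔ ∃ s, prolongParams s = ![c, d] := by
  rw [tableauMap_e1, tableauMap_e2]
  constructor
  · intro h
    have a := congrFun h
    simp [Fin.forall_fin_succ] at a
    obtain ⟨a0, a1, a2, a3, a4⟩ := a
    refine ⟨![c 0, c 2, c 4, c 5, d 1, d 3, c 3], ?_⟩
    funext i j
    fin_cases i <;> fin_cases j <;> simp [prolongParams] <;> linarith
  · rintro ⟨s, hs⟩
    obtain rfl : _ = c := congrFun hs 0
    obtain rfl : _ = d := congrFun hs 1
    funext i
    fin_cases i <;> simp [prolongParams]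

/-- The parametrization of the first prolongation of the tableau. -/
noncomputable def prolongMap :
    (Fin 7 → ℝ) →ₗ[ℝ] ((Fin 2 → ℝ) →ₗ[ℝ] ((Fin 2 → ℝ) →ₗ[ℝ] (Fin 5 → ℝ))) :=
  (homOfValues ((Fin 2 → ℝ) →ₗ[ℝ] (Fin 5 → ℝ))).toLinearMap ∘ₗ
    tableauMap.compLeft (Fin 2) ∘ₗ prolongParams

theorem prolongMap_e1 (s : Fin 7 → ℝ) : prolongMap s e1 = tableauMap (prolongParams s 0) :=
  homOfValues_e1 _

theorem prolongMap_e2 (s : Fin 7 → ℝ) : prolongMap s e2 = tableauMap (prolongParams s 1) :=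
  homOfValues_e2 _

theorem prolongMap_eq_zero (s : Fin 7 → ℝ) (h : prolongMap s = 0) : s = 0 := by
  have h1 := prolongMap_e1 s
  have h2 := prolongMap_e2 s
  rw [h, LinearMap.zero_apply] at h1 h2
  have a := congrFun (tableauMap_eq_zero _ h1.symm)
  have b := congrFun (tableauMap_eq_zero _ h2.symm)
  simp [prolongParams, Fin.forall_fin_succ] at a b
  funext i
  fin_cases i <;> simp <;> grind

theorem mem_prolong_W_iff (F : (Fin 2 → ℝ) →ₗ[ℝ] ((Fin 2 → ℝ) →ₗ[ℝ] (Fin 5 → ℝ))) :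
    F ∈ prolong W ↔ ∃ s, prolongMap s = F := by
  constructor
  · rintro ⟨hW, hF⟩
    obtain ⟨c, hc⟩ := (mem_W_iff _).1 (hW e1)
    obtain ⟨d, hd⟩ := (mem_W_iff _).1 (hW e2)
    rw [← hc, ← hd] at hF
    obtain ⟨s, hs⟩ := (tableauMap_symm_iff c d).1 hF
    refine ⟨s, hom_ext_e1_e2 ?_ ?_⟩
    · rw [prolongMap_e1, hs, ← hc]
      rfl
    · rw [prolongMap_e2, hs, ← hd]
      rfl
  · rintro ⟨s, rfl⟩
    refine ⟨fun v => ?_, ?_⟩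
    · rw [eq_smul_e1_add_smul_e2 v, map_add, map_smul, map_smul, prolongMap_e1, prolongMap_e2]
      exact W.add_mem (W.smul_mem _ ((mem_W_iff _).2 ⟨_, rfl⟩))
        (W.smul_mem _ ((mem_W_iff _).2 ⟨_, rfl⟩))
    · rw [prolongMap_e1, prolongMap_e2]
      refine (tableauMap_symm_iff _ _).2 ⟨s, ?_⟩
      funext i
      fin_cases i <;> rfl

theorem finrank_prolong_W : finrank ℝ (prolong W) = 7 :=
  finrank_eq_of_parametrization prolongMap prolongMap_eq_zero mem_prolong_W_iff

/-- For all real `λ, μ` with `λ·μ ≠ 0`, the subspace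
`{Q ∈ W : Q(λ·e1 + μ·e2) = 0}` of the Fubini–Cartan tableau `W` has
dimension 1.  Consequently the characters of `W` with respect to a generic
flag are `s'_1 = dim W − 1 = 6 − 1 = 5` and `s'_2 = dim W − s'_1 = 1`, and
since `dim W⁽¹⁾ = 7 = s'_1 + 2·s'_2 = 5 + 2·1`, the tableau `W` is
involutive. -/
theorem fubiniCartan_involutive :
    (∀ lam mu : ℝ, lam * mu ≠ 0 →
      finrank ℝ (vanishAt W (lam • e1 + mu • e2)) = 1) ∧
    finrank ℝ W = 6 ∧
    finrank ℝ (prolong W) = 5 + 2 * 1 :=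
  ⟨fun _ _ h => finrank_vanishAt_W h, finrank_W, finrank_prolong_W⟩
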